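/- For every coloring c of the ordered pairs of distinct ordinals of ω₂ with countably many colors, there exists a sequence (β_i : i ∈ ω) of pairwise distinct ordinals below ω₂ such that the set {c(β_i, β_{i+1}) : i ∈ ω} ∪ {c(β_{i+1}, β_i) : i ∈ ω} has at most two elements. -/

import Mathlib

open Cardinal

theorem path_of_infinite_degree {V : Type*} (G : V → V → Prop) (S : Set V) (hS : S.Nonempty)
    (h : ∀ v ∈ S, {w | w ∈ S ∧ G v w}.Infinite) :
    ∃ f : ℕ → V, Function.Injective f ∧ (∀ n, f n ∈ S) ∧ ∀ n, G (f n) (f (n + 1)) := by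
  classical
  have step : ∀ s : Finset V × S, ∃ w : S, G s.2 w ∧ (w : V) ∉ insert (s.2 : V) s.1 := by
    rintro ⟨F, v, hv⟩
    obtain ⟨w, hw, hw'⟩ := (h v hv).exists_notMem_finset (insert v F)
    exact ⟨⟨w, hw.1⟩, hw.2, hw'⟩
  choose g hg hg' using step
  obtain ⟨v0, hv0⟩ := hS
  let s : ℕ → Finset V × S := fun n =>
    Nat.rec (∅, ⟨v0, hv0⟩) (fun _ s => (insert (s.2 : V) s.1, g s)) n
  have hs : ∀ n, s (n + 1) = (insert ((s n).2 : V) (s n).1, g (s n)) := fun n => rfl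
  have key : ∀ m k, ((s m).2 : V) ∈ (s (m + 1 + k)).1 := by
    intro m k
    induction k with
    | zero => simp [hs]
    | succ k ih => rw [← add_assoc, hs]; exact Finset.mem_insert_of_mem ih
  have hn : ∀ n, ((s n).2 : V) ∉ (s n).1 := by
    intro n
    cases n with
    | zero => simp [s]
    | succ n => rw [hs]; exact hg' (s n)
  have hlt : ∀ m n, m < n → ((s m).2 : V) ≠ (s n).2 := by
    intro m n hmn e
    obtain ⟨k, rfl⟩ := Nat.exists_eq_add_of_le (Nat.succ_le_of_lt hmn)
    exact hn _ (e ▸ key m k)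
  refine ⟨fun n => (s n).2, ?_, fun n => (s n).2.2, fun n => ?_⟩
  · intro m n e
    rcases lt_trichotomy m n with h | h | h
    · exact (hlt _ _ h e).elim
    · exact h
    · exact (hlt _ _ h e.symm).elim
  · exact hg (s n)

theorem path_aux {V : Type*} (c : V → V → ℕ) (A B : Set V) (hA : #A ≤ ℵ₁)
    (hA' : ¬ A.Countable) (hB : ¬ #B ≤ ℵ₁) :
    ∃ f : ℕ → V, Function.Injective f ∧ (∀ n, f n ∈ A ∪ B) ∧ ∃ x y : ℕ, ∀ i,
      c (f i) (f (i + 1)) ∈ ({x, y} : Set ℕ) ∧ c (f (i + 1)) (f i) ∈ ({x, y} : Set ℕ) := by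
  have h1 : ∀ b, ∃ p : ℕ × ℕ, {a | a ∈ A ∧ (c a b, c b a) = p}.Infinite := by
    intro b
    by_contra! hcon
    apply hA'
    have : A = ⋃ p : ℕ × ℕ, {a | a ∈ A ∧ (c a b, c b a) = p} := by
      ext a; simp
    rw [this]
    exact Set.countable_iUnion fun p => (Set.not_infinite.1 (by simpa using hcon p)).countable
  choose P hP using h1
  obtain ⟨p, hp⟩ : ∃ p, ¬ #{b | b ∈ B ∧ P b = p} ≤ ℵ₁ := by
    by_contra! hcon
    apply hB
    have : B = ⋃ p : ℕ × ℕ, {b | b ∈ B ∧ P b = p} := by ext a; simp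
    rw [this]
    have := Cardinal.mk_iUnion_le_lift (fun p : ℕ × ℕ => {b | b ∈ B ∧ P b = p})
    simp only [Cardinal.lift_id'.{0}, Cardinal.lift_uzero, Cardinal.mk_eq_aleph0,
      Cardinal.lift_aleph0] at this
    refine this.trans ((mul_le_mul' (Cardinal.aleph0_le_aleph 1) (ciSup_le' hcon)).trans ?_)
    rw [Cardinal.mul_eq_self (Cardinal.aleph0_le_aleph 1)]
  let N : V → Set V := fun a => {b | (b ∈ B ∧ P b = p) ∧ (c a b, c b a) = p}
  let Bad : Set V := ⋃ a ∈ {a | a ∈ A ∧ #(N a) ≤ ℵ₁}, N a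
  have hBad : #Bad ≤ ℵ₁ := by
    refine (Cardinal.mk_biUnion_le _ _).trans ?_
    refine (mul_le_mul' ((Cardinal.mk_le_mk_of_subset (fun a h => h.1)).trans hA)
      (ciSup_le' fun a => a.2.2)).trans ?_
    rw [Cardinal.mul_eq_self (Cardinal.aleph0_le_aleph 1)]
  have union_small : ∀ X : Set V, #(X \ Bad : Set V) ≤ ℵ₁ → #X ≤ ℵ₁ := by
    intro X hX
    have : X ⊆ (X \ Bad) ∪ Bad := by intro x hx; by_cases h : x ∈ Bad <;> simp [h, hx]
    refine (Cardinal.mk_le_mk_of_subset this).trans ((Cardinal.mk_union_le _ _).trans ?_)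
    exact (add_le_add hX hBad).trans (Cardinal.add_eq_self (Cardinal.aleph0_le_aleph 1)).le
  let A2 : Set V := {a | a ∈ A ∧ ¬ #(N a) ≤ ℵ₁}
  let B2 : Set V := {b | b ∈ B ∧ P b = p} \ Bad
  let G : V → V → Prop := fun u v =>
    (c u v, c v u) = p ∨ (c v u, c u v) = p
  have hfin : ∀ X : Set V, X.Finite → #X ≤ ℵ₁ := fun X hX =>
    (Cardinal.mk_le_aleph0_iff.2 hX.countable).trans (Cardinal.aleph0_le_aleph 1)
  have hne : (A2 ∪ B2).Nonempty := by
    by_contra! hcon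
    apply hp
    apply union_small
    have : B2 = ∅ := by
      apply Set.eq_empty_of_subset_empty; rw [← hcon]; exact Set.subset_union_right
    exact hfin B2 (this ▸ Set.finite_empty)
  obtain ⟨f, hf, hfS, hfG⟩ := path_of_infinite_degree G (A2 ∪ B2) hne (by
    rintro v (hv | hv)
    · intro hF
      apply hv.2
      apply union_small
      apply hfin
      refine hF.subset ?_
      rintro b ⟨hb, hb'⟩
      exact ⟨Or.inr ⟨hb.1, hb'⟩, Or.inl hb.2⟩
    · refine (hP v).mono ?_
      rintro a ⟨ha, ha'⟩
      rw [hv.1.2] at ha'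
      refine ⟨Or.inl ⟨ha, fun hsm => hv.2 ?_⟩, Or.inr ha'⟩
      exact Set.mem_biUnion (show a ∈ {a | a ∈ A ∧ #(N a) ≤ ℵ₁} from ⟨ha, hsm⟩) ⟨hv.1, ha'⟩)
  refine ⟨f, hf, fun n => (hfS n).imp (fun h => h.1) (fun h => h.1.1), p.1, p.2, fun i => ?_⟩
  rcases hfG i with h | h <;> rw [← h] <;> simp

/-- For every coloring `c` of the ordered pairs of distinct ordinals below `ℵ₂`
with countably many colors, there is a sequence of pairwise distinct ordinals
below `ℵ₂` such that the colors of the consecutive pairs, in both orders, assume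
at most two values. -/
theorem omega2_ordered_path_two_colors (c : Ordinal → Ordinal → ℕ) :
    ∃ β : ℕ → Ordinal, Function.Injective β ∧
      (∀ n, β n < (Cardinal.aleph 2).ord) ∧
      ∃ x y : ℕ, ∀ i : ℕ,
        c (β i) (β (i + 1)) ∈ ({x, y} : Set ℕ) ∧
        c (β (i + 1)) (β i) ∈ ({x, y} : Set ℕ) := by
  have h12 : Cardinal.aleph 1 < Cardinal.aleph 2 := Cardinal.aleph_lt_aleph.2 (by norm_num)
  obtain ⟨f, hf, hf', h⟩ := path_aux c (Set.Iio (Cardinal.aleph 1).ord)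
    (Set.Iio (Cardinal.aleph 2).ord)
    (by rw [Cardinal.mk_Iio_ordinal]; simp)
    (by rw [← Cardinal.le_aleph0_iff_set_countable, Cardinal.mk_Iio_ordinal]; simp)
    (by rw [Cardinal.mk_Iio_ordinal]; simp)
  refine ⟨f, hf, fun n => ?_, h⟩
  rcases hf' n with h | h
  · exact lt_trans h (Cardinal.ord_lt_ord.2 h12)
  · exact h
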